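/- Let k ≥ 2 be an integer and A ⊆ ℕ such that R_{1,k}(A,n) = R_{1,k}(ℕ\A,n) for all n ≥ n₀. Then R_{1,k}(A,n) ≥ ⌊⌊log_k(n/T)⌋/4⌋ for all sufficiently large n, where T = ⌊(n₀+k)/k⌋ + 1. -/

import Mathlib

noncomputable def R (k : ℕ) (A : Set ℕ) (n : ℕ) : ℕ :=
  Set.ncard {p : ℕ × ℕ | p.1 ∈ A ∧ p.2 ∈ A ∧ p.1 + k * p.2 = n}

open Classical in
noncomputable def chi (A : Set ℕ) (t : ℕ) : ℕ := if t ∈ A then 1 else 0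

open Finset in
theorem R_eq_sum_chi {k : ℕ} (hk : 0 < k) (A : Set ℕ) (n : ℕ) :
    R k A n = ∑ b ∈ range (n / k + 1), chi A b * chi A (n - k * b) := by
  classical
  have hset : {p : ℕ × ℕ | p.1 ∈ A ∧ p.2 ∈ A ∧ p.1 + k * p.2 = n} =
      (((range (n / k + 1)).filter fun b => b ∈ A ∧ n - k * b ∈ A).image
        fun b => (n - k * b, b) : Finset (ℕ × ℕ)) := by
    ext ⟨x, b⟩
    simp only [Set.mem_ofPred_eq, coe_image, coe_filter, mem_range, Set.mem_image, Prod.mk.injEq]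
    constructor
    · rintro ⟨hx, hb, hn⟩
      have hxe : n - k * b = x := by omega
      refine ⟨b, ⟨?_, hb, hxe ▸ hx⟩, hxe, rfl⟩
      rw [Nat.lt_succ_iff, Nat.le_div_iff_mul_le hk, mul_comm]
      omega
    · rintro ⟨b', ⟨hlt, hb, hx⟩, rfl, rfl⟩
      rw [Nat.lt_succ_iff, Nat.le_div_iff_mul_le hk, mul_comm] at hlt
      exact ⟨hx, hb, by omega⟩
  rw [R, hset, Set.ncard_coe_finset, card_image_of_injective _ fun _ _ h => (Prod.ext_iff.1 h).2,
    card_filter]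
  refine sum_congr rfl fun b _ => ?_
  by_cases h₁ : b ∈ A <;> by_cases h₂ : n - k * b ∈ A <;> simp [chi, h₁, h₂]

theorem chi_add_chi_compl (A : Set ℕ) (t : ℕ) : chi A t + chi Aᶜ t = 1 := by
  by_cases h : t ∈ A <;> simp [chi, h]

open Finset in
theorem R_sub_R_compl {k : ℕ} (hk : 0 < k) (A : Set ℕ) (n : ℕ) :
    (R k A n : ℤ) - R k Aᶜ n =
      ∑ b ∈ range (n / k + 1), (chi A b : ℤ) +
        ∑ b ∈ range (n / k + 1), (chi A (n - k * b) : ℤ) - (n / k + 1 : ℕ) := by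
  rw [R_eq_sum_chi hk, R_eq_sum_chi hk]
  push_cast
  rw [← sum_sub_distrib, ← sum_add_distrib, eq_sub_iff_add_eq]
  have hcard : ((n : ℤ) / k + 1) = ∑ b ∈ range (n / k + 1), (1 : ℤ) := by simp
  rw [hcard, ← sum_add_distrib]
  refine sum_congr rfl fun b _ => ?_
  have h₁ : (chi Aᶜ b : ℤ) = 1 - chi A b := by
    have := chi_add_chi_compl A b
    omega
  have h₂ : (chi Aᶜ (n - k * b) : ℤ) = 1 - chi A (n - k * b) := by
    have := chi_add_chi_compl A (n - k * b)
    omega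
  rw [h₁, h₂]
  ring

theorem mem_add_iff_div_notMem {k n : ℕ} (hk : 0 < k) {A : Set ℕ} (h₀ : R k A n = R k Aᶜ n)
    (h₁ : R k A (n + k) = R k Aᶜ (n + k)) : n + k ∈ A ↔ (n + k) / k ∉ A := by
  have e₀ := R_sub_R_compl hk A n
  have e₁ := R_sub_R_compl hk A (n + k)
  have hshift (b : ℕ) : n + k - k * (b + 1) = n - k * b := by
    rw [mul_add, mul_one]; omega
  rw [Nat.add_div_right n hk] at e₁ ⊢
  rw [Finset.sum_range_succ _ (n / k + 1), Finset.sum_range_succ' _ (n / k + 1)] at e₁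
  simp only [hshift, mul_zero, Nat.sub_zero] at e₁
  have key : (chi A (n + k) : ℤ) + chi A (n / k + 1) = 1 := by
    push_cast at e₀ e₁
    rw [h₀, sub_self] at e₀
    rw [h₁, sub_self] at e₁
    linarith
  by_cases h₂ : n + k ∈ A <;> by_cases h₃ : n / k + 1 ∈ A <;> simp [chi, h₂, h₃] at key ⊢

section Flip

variable {k T : ℕ} {A : Set ℕ}

theorem mem_iff_mem_of_div_pow_eq (hflip : ∀ x, T ≤ x / k → (x ∈ A ↔ x / k ∉ A)) (a : ℕ) :
    ∀ x y, T ≤ x / k ^ a → x / k ^ a = y / k ^ a → T ≤ x → T ≤ y → (x ∈ A ↔ y ∈ A) := by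
  induction a with
  | zero =>
    intro x y _ hxy _ _
    simp only [pow_zero, Nat.div_one] at hxy
    rw [hxy]
  | succ a ih =>
    intro x y hx hxy _ _
    rw [pow_succ', ← Nat.div_div_eq_div_mul] at hx
    rw [pow_succ', ← Nat.div_div_eq_div_mul, ← Nat.div_div_eq_div_mul] at hxy
    have hx' : T ≤ x / k := hx.trans (Nat.div_le_self _ _)
    have hy' : T ≤ y / k := (hxy ▸ hx).trans (Nat.div_le_self _ _)
    rw [hflip x hx', hflip y hy', ih _ _ hx hxy hx' hy']

theorem pow_dvd_of_mem_change (hk : 0 < k) (hflip : ∀ x, T ≤ x / k → (x ∈ A ↔ x / k ∉ A))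
    {a x : ℕ} (hx : T * k ^ a ≤ x) (hne : ¬(x ∈ A ↔ x + 1 ∈ A)) : k ^ a ∣ x + 1 := by
  by_contra hd
  have hTx : T ≤ x := (Nat.le_mul_of_pos_right T (pow_pos hk a)).trans hx
  refine hne (mem_iff_mem_of_div_pow_eq hflip a x (x + 1) ?_ ?_ hTx (by omega))
  · rwa [Nat.le_div_iff_mul_le (pow_pos hk a)]
  · rw [Nat.succ_div, if_neg hd, add_zero]

theorem exists_mem_change (hk : 2 ≤ k) (hflip : ∀ x, T ≤ x / k → (x ∈ A ↔ x / k ∉ A)) :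
    ∃ c, T ≤ c ∧ c + 1 ≤ k * T ∧ ¬(c ∈ A ↔ c + 1 ∈ A) := by
  by_contra! hc
  have hconst (d : ℕ) : T + d ≤ k * T → (T ∈ A ↔ T + d ∈ A) := by
    induction d with
    | zero => simp
    | succ d ih =>
      intro hd
      exact (ih (by omega)).trans (hc (T + d) (by omega) (by omega))
  have hle : T ≤ k * T := Nat.le_mul_of_pos_left T (by omega)
  have h₁ := hconst (k * T - T) (by omega)
  rw [Nat.add_sub_cancel' hle] at h₁
  have hdiv : k * T / k = T := Nat.mul_div_cancel_left T (by omega)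
  have h₂ := hflip (k * T) hdiv.ge
  rw [hdiv] at h₂
  tauto

theorem mem_change_mul (hk : 0 < k) (hflip : ∀ x, T ≤ x / k → (x ∈ A ↔ x / k ∉ A))
    {c : ℕ} (hc : T ≤ c) (hne : ¬(c ∈ A ↔ c + 1 ∈ A)) :
    ¬(k * (c + 1) - 1 ∈ A ↔ k * (c + 1) ∈ A) := by
  have h₁ : (k * (c + 1) - 1) / k = c := by
    rw [Nat.div_eq_iff hk]
    have : k * (c + 1) = c * k + k := by ring
    omega
  have h₂ : k * (c + 1) / k = c + 1 := Nat.mul_div_cancel_left _ hk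
  have h₃ := hflip _ (hc.trans h₁.ge)
  have h₄ := hflip (k * (c + 1)) (by omega)
  rw [h₁] at h₃
  rw [h₂] at h₄
  tauto

theorem mem_change_pow_mul (hk : 0 < k) (hflip : ∀ x, T ≤ x / k → (x ∈ A ↔ x / k ∉ A))
    {c : ℕ} (hc : T ≤ c) (hne : ¬(c ∈ A ↔ c + 1 ∈ A)) (j : ℕ) :
    ¬(k ^ j * (c + 1) - 1 ∈ A ↔ k ^ j * (c + 1) ∈ A) := by
  induction j with
  | zero => simpa using hne
  | succ j ih =>
    have hle : c + 1 ≤ k ^ j * (c + 1) := Nat.le_mul_of_pos_left _ (pow_pos hk j)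
    have hs : k ^ j * (c + 1) - 1 + 1 = k ^ j * (c + 1) := by omega
    have := mem_change_mul hk hflip (c := k ^ j * (c + 1) - 1) (by omega) (by rwa [hs])
    rwa [hs, ← mul_assoc, ← pow_succ'] at this

/-- Two consecutive scaled jumps of `A` cannot both be mirrored by `i ↦ q - i`. -/
theorem exists_mirror_conflict (hk : 2 ≤ k) (hflip : ∀ x, T ≤ x / k → (x ∈ A ↔ x / k ∉ A))
    {a d q : ℕ} (hd : 0 < d) (hda : d < k ^ a) (hq : k * d + T * k ^ a ≤ q)
    (h₁ : ¬(d - 1 ∈ A ↔ d ∈ A)) (h₂ : ¬(k * d - 1 ∈ A ↔ k * d ∈ A)) :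
    ∃ i, d - 1 ≤ i ∧ i ≤ k * d ∧ ¬(i ∈ A ↔ q - i ∈ A) := by
  by_contra! hcon
  have hdk : 2 * d ≤ k * d := Nat.mul_le_mul_right d hk
  have mirror (e : ℕ) (he : d ≤ e) (hek : e ≤ k * d) (hne : ¬(e - 1 ∈ A ↔ e ∈ A)) :
      k ^ a ∣ q - e + 1 := by
    refine pow_dvd_of_mem_change (by omega) hflip (by omega) ?_
    have e₁ := hcon (e - 1) (by omega) (by omega)
    have e₂ := hcon e (by omega) hek
    rw [show q - (e - 1) = q - e + 1 by omega] at e₁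
    tauto
  have d₁ := mirror d le_rfl (by omega) h₁
  have d₂ := mirror (k * d) (by omega) le_rfl h₂
  have d₃ : k ^ a ∣ (k - 1) * d := by
    have := Nat.dvd_sub d₁ d₂
    rwa [show q - d + 1 - (q - k * d + 1) = (k - 1) * d by rw [Nat.sub_one_mul]; omega] at this
  have hcop : Nat.Coprime (k ^ a) (k - 1) := by
    refine Nat.Coprime.pow_left a ?_
    have := Nat.coprime_self_add_left (m := k - 1) (n := 1)
    rw [Nat.sub_add_cancel (by omega)] at this
    exact this.2 (Nat.coprime_one_left _)
  exact absurd (Nat.le_of_dvd hd (hcop.dvd_of_dvd_mul_left d₃)) (by omega)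

/-- Each mirror conflict `i ↔ n / k - i` yields a representation of `n`. -/
theorem le_R_of_conflicts (hk : 0 < k) (hflip : ∀ x, T ≤ x / k → (x ∈ A ↔ x / k ∉ A))
    {n M : ℕ} (i : ℕ → ℕ) (hmono : StrictMono i) (hT : ∀ t < M, T ≤ i t)
    (hlt : ∀ t < M, 2 * i t < n / k) (hconf : ∀ t < M, ¬(i t ∈ A ↔ n / k - i t ∈ A)) :
    M ≤ R k A n := by
  classical
  let b (t : ℕ) : ℕ := if i t ∈ A then i t else n / k - i t
  have hfin : {p : ℕ × ℕ | p.1 ∈ A ∧ p.2 ∈ A ∧ p.1 + k * p.2 = n}.Finite := by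
    refine ((Set.finite_Iic n).prod (Set.finite_Iic n)).subset ?_
    rintro ⟨x, y⟩ ⟨-, -, hxy⟩
    have := Nat.le_mul_of_pos_left y hk
    simp only at hxy
    exact ⟨Set.mem_Iic.2 (by dsimp; omega), Set.mem_Iic.2 (by dsimp; omega)⟩
  have hn := Nat.div_add_mod n k
  have hmod := Nat.mod_lt n hk
  rw [R, ← Finset.card_range M, ← Set.ncard_coe_finset]
  refine Set.ncard_le_ncard_of_injOn (fun t => (n - k * b t, b t)) ?_ ?_ hfin
  · intro t ht
    have ht : t < M := by simpa using ht
    have hc := hconf t ht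
    have hl := hlt t ht
    have hi := hT t ht
    have hbA : b t ∈ A := by
      simp only [b]; split_ifs <;> tauto
    have hbn : n / k - b t ∉ A := by
      simp only [b]; split_ifs with h
      · tauto
      · rwa [show n / k - (n / k - i t) = i t by omega]
    have hb : b t ≤ n / k ∧ T ≤ n / k - b t := by
      simp only [b]; split_ifs <;> omega
    have hmul : k * b t ≤ k * (n / k) := Nat.mul_le_mul_left k hb.1
    have hdiv : (n - k * b t) / k = n / k - b t := Nat.sub_mul_div n k (b t)
    refine ⟨?_, hbA, ?_⟩
    · exact (hflip _ (hdiv ▸ hb.2)).2 (hdiv ▸ hbn)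
    · dsimp only; omega
  · intro t ht u hu htu
    have ht : t < M := by simpa using ht
    have hu : u < M := by simpa using hu
    have hbb : b t = b u := (Prod.ext_iff.1 htu).2
    have hlt₁ := hlt t ht
    have hlt₂ := hlt u hu
    apply hmono.injective
    simp only [b] at hbb
    split_ifs at hbb <;> omega

end Flip

theorem le_R_of_mul_pow_le {k T : ℕ} {A : Set ℕ} (hk : 2 ≤ k) (hT : 2 ≤ T)
    (hflip : ∀ x, T ≤ x / k → (x ∈ A ↔ x / k ∉ A)) {n M : ℕ} (hM : T + 2 ≤ M)
    (hn : T * k ^ (4 * M) ≤ n) : M ≤ R k A n := by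
  have hk₀ : 0 < k := by omega
  obtain ⟨c, hTc, hck, hne⟩ := exists_mem_change hk hflip
  have hchange := mem_change_pow_mul hk₀ hflip hTc hne
  set a := 2 * M + T with ha
  have hTa : k ^ (2 * M) * T ≤ k ^ a := by
    rw [ha, pow_add]
    exact Nat.mul_le_mul_left _ (Nat.lt_pow_self hk).le
  have hq : 2 * (T * k ^ a) ≤ n / k := by
    rw [Nat.le_div_iff_mul_le hk₀]
    calc 2 * (T * k ^ a) * k ≤ k * (T * k ^ a) * k := by gcongr
      _ = T * k ^ (a + 2) := by ring
      _ ≤ T * k ^ (4 * M) := Nat.mul_le_mul_left T (Nat.pow_le_pow_right hk₀ (by omega))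
      _ ≤ n := hn
  have htop (t : ℕ) (ht : t < M) : k ^ (2 * t + 1) * (c + 1) ≤ k ^ (2 * M) * T :=
    calc k ^ (2 * t + 1) * (c + 1) ≤ k ^ (2 * t + 1) * (k * T) := Nat.mul_le_mul_left _ hck
      _ = k ^ (2 * t + 2) * T := by ring
      _ ≤ k ^ (2 * M) * T := Nat.mul_le_mul_right T (Nat.pow_le_pow_right hk₀ (by omega))
  have hTaa : 2 * k ^ a ≤ T * k ^ a := Nat.mul_le_mul_right _ hT
  have hstep (j : ℕ) : k ^ (j + 1) * (c + 1) = k * (k ^ j * (c + 1)) := by ring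
  have hpos (j : ℕ) : c + 1 ≤ k ^ j * (c + 1) := Nat.le_mul_of_pos_left _ (pow_pos hk₀ j)
  have hdouble (j : ℕ) : 2 * (k ^ j * (c + 1)) ≤ k ^ (j + 1) * (c + 1) := by
    rw [hstep]
    exact Nat.mul_le_mul_right _ hk
  have hex (t : ℕ) : ∃ i, k ^ (2 * t) * (c + 1) - 1 ≤ i ∧ i ≤ k ^ (2 * t + 1) * (c + 1) ∧
      (t < M → ¬(i ∈ A ↔ n / k - i ∈ A)) := by
    have hd := hdouble (2 * t)
    by_cases ht : t < M
    · have hp := hpos (2 * t)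
      have ht' := htop t ht
      have h₂ := hchange (2 * t + 1)
      rw [hstep] at h₂ ht' hd ⊢
      obtain ⟨i, h₃, h₄, h₅⟩ := exists_mirror_conflict (a := a) (q := n / k) hk hflip (by omega)
        (by omega) (by omega) (hchange (2 * t)) h₂
      exact ⟨i, h₃, h₄, fun _ => h₅⟩
    · exact ⟨_, le_rfl, by omega, fun h => absurd h ht⟩
  choose i hlo hhi hconf using hex
  refine le_R_of_conflicts hk₀ hflip i (strictMono_nat_of_lt_succ fun t => ?_) ?_ ?_ hconf
  · have h₁ := hlo (t + 1)
    have h₂ := hhi t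
    have h₃ := hdouble (2 * t + 1)
    have h₄ := hpos (2 * t + 1)
    rw [show 2 * (t + 1) = 2 * t + 1 + 1 by ring] at h₁
    omega
  · intro t _
    have h₁ := hlo t
    have h₂ := hpos (2 * t)
    omega
  · intro t ht
    have h₁ := hhi t
    have h₂ := htop t ht
    have h₃ : 0 < k ^ a := pow_pos hk₀ a
    omega

theorem mul_pow_le_of_le_logb {k T n m : ℕ} (hk : 2 ≤ k) (hT : 0 < T) (hn : 0 < n)
    (h : (m : ℝ) ≤ Real.logb k ((n : ℝ) / T)) : T * k ^ m ≤ n := by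
  have hk' : (1 : ℝ) < k := by exact_mod_cast hk
  have hT' : (0 : ℝ) < T := by exact_mod_cast hT
  have hn' : (0 : ℝ) < n := by exact_mod_cast hn
  rw [Real.le_logb_iff_rpow_le hk' (by positivity), Real.rpow_natCast, le_div_iff₀ hT',
    mul_comm] at h
  exact_mod_cast h

theorem le_logb_of_mul_pow_le {k T n m : ℕ} (hk : 2 ≤ k) (hT : 0 < T)
    (h : T * k ^ m ≤ n) : (m : ℝ) ≤ Real.logb k ((n : ℝ) / T) := by
  have hk' : (1 : ℝ) < k := by exact_mod_cast hk
  have hT' : (0 : ℝ) < T := by exact_mod_cast hT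
  have hn : 0 < n := (Nat.mul_pos hT (pow_pos (by omega) m)).trans_le h
  have hn' : (0 : ℝ) < n := by exact_mod_cast hn
  rw [Real.le_logb_iff_rpow_le hk' (by positivity), Real.rpow_natCast, le_div_iff₀ hT', mul_comm]
  exact_mod_cast h

theorem stmt_14 (k n₀ : ℕ) (hk : 2 ≤ k) (A : Set ℕ)
    (h : ∀ n, n₀ ≤ n → R k A n = R k Aᶜ n)
    (T : ℕ) (hT : T = (n₀ + k) / k + 1) :
    ∃ N : ℕ, ∀ n : ℕ, N ≤ n →
      ⌊Real.logb k ((n : ℝ) / T)⌋ / 4 ≤ (R k A n : ℤ) := by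
  have hk₀ : 0 < k := by omega
  rw [Nat.add_div_right _ hk₀] at hT
  have hT₂ : 2 ≤ T := hT ▸ Nat.le_add_left 2 (n₀ / k)
  have hflip (x : ℕ) (hx : T ≤ x / k) : x ∈ A ↔ x / k ∉ A := by
    have hle : n₀ + k ≤ x := by
      rw [Nat.le_div_iff_mul_le hk₀, hT] at hx
      have := Nat.div_add_mod n₀ k
      have := Nat.mod_lt n₀ hk₀
      have : (n₀ / k + 1 + 1) * k = k * (n₀ / k) + k + k := by ring
      omega
    obtain ⟨n, rfl⟩ := Nat.exists_eq_add_of_le' (show k ≤ x by omega)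
    exact mem_add_iff_div_notMem hk₀ (h n (by omega)) (h (n + k) (by omega))
  refine ⟨T * k ^ (4 * (T + 2)), fun n hn => ?_⟩
  have hn₀ : 0 < n := (Nat.mul_pos (by omega) (pow_pos hk₀ _)).trans_le hn
  set L := ⌊Real.logb k ((n : ℝ) / T)⌋ with hL
  have hlow : ((4 * (T + 2) : ℕ) : ℤ) ≤ L := by
    rw [hL, Int.le_floor]
    exact_mod_cast le_logb_of_mul_pow_le hk (by omega) hn
  obtain ⟨M, hM⟩ := Int.eq_ofNat_of_zero_le (show 0 ≤ L / 4 by omega)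
  rw [hM]
  have hML : ((4 * M : ℕ) : ℤ) ≤ L := by omega
  rw [hL, Int.le_floor] at hML
  exact_mod_cast le_R_of_mul_pow_le hk (by omega) hflip (by omega)
    (mul_pow_le_of_le_logb hk (by omega) hn₀ (by exact_mod_cast hML))
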